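/- Let a, b, s ∈ ℝ be such that the natural parameterization r is differentiable at b, 0 ≠ r(b) − r(a) = ‖r(b) − r(a)‖·r(s), and r'(b) = x·r(s) + y·r'±(s) with y ≠ 0. Then r is differentiable at s if and only if the function ν : ℝ → ℝ, ν(ε) = ‖r(b+ε) − r(a)‖, is differentiable at 0. -/

import Mathlib

open Metric Set Filter Topology

set_option maxHeartbeats 2000000

lemma aux_strict {X : Type*} [NormedAddCommGroup X] [NormedSpace ℝ X] {u : X}
    (h : DifferentiableAt ℝ (fun z : X => ‖z‖) u) :
    HasStrictFDerivAt (fun z : X => ‖z‖) (fderiv ℝ (fun z : X => ‖z‖) u) u := by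
  set φ := fderiv ℝ (fun z : X => ‖z‖) u with hφ
  have hd : HasFDerivAt (fun z : X => ‖z‖) φ u := h.hasFDerivAt
  refine HasStrictFDerivAt.of_isLittleO ?_
  rw [Asymptotics.isLittleO_iff]
  intro c hc
  have h1 := hd.isLittleO
  rw [Asymptotics.isLittleO_iff] at h1
  have h2 := h1 (c := c / 4) (by positivity)
  obtain ⟨ρ, hρ, hb⟩ := Metric.eventually_nhds_iff.1 h2
  set F : X → ℝ := fun z => ‖z‖ - ‖u‖ - φ (z - u) with hF
  have hconv : ConvexOn ℝ (ball u ρ) F := by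
    refine ⟨convex_ball _ _, ?_⟩
    intro a _ b _ s t hs ht hst
    have e1 : ‖s • a + t • b‖ ≤ s * ‖a‖ + t * ‖b‖ := by
      refine (norm_add_le _ _).trans ?_
      rw [norm_smul, norm_smul, Real.norm_of_nonneg hs, Real.norm_of_nonneg ht]
    simp only [hF, map_sub, map_add, map_smul, smul_eq_mul]
    have : t = 1 - s := by linarith
    subst this
    nlinarith
  have hM : ∀ a, dist a u < ρ → |F a| ≤ c / 4 * ρ := by
    intro a ha
    have := hb ha
    simp only [Real.norm_eq_abs] at this
    refine this.trans ?_
    rw [dist_eq_norm] at ha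
    gcongr
  have hL := hconv.lipschitzOnWith_of_abs_le (ε := ρ / 2) (by positivity) hM
  have hK : 2 * (c / 4 * ρ) / (ρ / 2) = c := by field_simp; ring
  rw [hK] at hL
  have hmem : ball u (ρ - ρ / 2) ∈ 𝓝 u := ball_mem_nhds _ (by linarith)
  filter_upwards [prod_mem_nhds hmem hmem] with z hz
  have := hL.dist_le_mul z.1 hz.1 z.2 hz.2
  rw [Real.coe_toNNReal _ hc.le, dist_eq_norm, dist_eq_norm] at this
  convert this using 2
  simp only [hF, map_sub]; ring

lemma aux_sigma {X : Type*} [NormedAddCommGroup X] [NormedSpace ℝ X] [FiniteDimensional ℝ X]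
    [CompleteSpace X] (p : ℝ → X) (C : NNReal) (hp : LipschitzWith C p)
    (σ : ℝ → ℝ) (hσ : ∀ t, σ t = ∫ u in (0:ℝ)..t, ‖derivWithin p (Ici u) u‖) :
    (∀ u v, |σ u - σ v| ≤ C * |u - v|) ∧
    ∀ t p', HasStrictDerivAt p p' t → HasDerivAt σ ‖p'‖ t := by
  have hae : ∀ᵐ u : ℝ, DifferentiableAt ℝ p u := hp.ae_differentiableAt_real
  have hσ' : σ = fun t => ∫ u in (0:ℝ)..t, ‖deriv p u‖ := by
    funext t
    rw [hσ]
    refine intervalIntegral.integral_congr_ae ?_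
    filter_upwards [hae] with u hu _
    rw [hu.derivWithin (uniqueDiffOn_Ici u u self_mem_Ici)]
  have hmeas : MeasureTheory.StronglyMeasurable (fun u => ‖deriv p u‖) :=
    (stronglyMeasurable_deriv p).norm
  have hbd : ∀ u, ‖deriv p u‖ ≤ C := fun u => norm_deriv_le_of_lipschitz hp
  have hInt : ∀ a b, IntervalIntegrable (fun u => ‖deriv p u‖) MeasureTheory.volume a b := by
    intro a b
    refine (intervalIntegrable_const (c := (C : ℝ))).mono_fun hmeas.aestronglyMeasurable ?_
    filter_upwards with u
    simpa using hbd u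
  subst hσ'
  refine ⟨?_, ?_⟩
  · intro u v
    simp only
    rw [intervalIntegral.integral_interval_sub_left (hInt _ _) (hInt _ _)]
    have := intervalIntegral.norm_integral_le_of_norm_le_const (a := v) (b := u) (C := C)
      (f := fun u => ‖deriv p u‖) (by intro x _; simpa using hbd x)
    simpa using this
  · intro t p' h
    refine intervalIntegral.integral_hasDerivAt_of_tendsto_ae_right (hInt _ _)
      hmeas.stronglyMeasurableAtFilter ?_
    refine Tendsto.norm ?_
    rw [Metric.tendsto_nhds]
    intro ε hε
    have hq : HasStrictDerivAt (fun z => p z - z • p') 0 t := by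
      simpa using h.fun_sub ((hasStrictDerivAt_id t).smul_const p')
    obtain ⟨s, hs, hL⟩ := hq.hasStrictFDerivAt.exists_lipschitzOnWith_of_nnnorm_lt
      (⟨ε / 2, by positivity⟩ : NNReal) (by
        simp; exact_mod_cast (half_pos hε))
    have e1 : ∀ᶠ u in 𝓝 t ⊓ MeasureTheory.ae MeasureTheory.volume, s ∈ 𝓝 u :=
      (eventually_mem_nhds_iff.2 hs).filter_mono inf_le_left
    have e2 : ∀ᶠ u in 𝓝 t ⊓ MeasureTheory.ae MeasureTheory.volume, DifferentiableAt ℝ p u :=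
      Eventually.filter_mono inf_le_right hae
    filter_upwards [e1, e2] with u hu hd
    have h1 : HasDerivAt (fun z => p z - z • p') (deriv p u - p') u := by
      simpa using hd.hasDerivAt.fun_sub ((hasDerivAt_id u).smul_const p')
    have := h1.le_of_lipschitzOn hu hL
    rw [dist_eq_norm]
    refine this.trans_lt ?_
    show ε / 2 < ε
    linarith

lemma aux_norm_diff {X : Type*} [NormedAddCommGroup X] [NormedSpace ℝ X] [FiniteDimensional ℝ X]
    (hdim : Module.finrank ℝ X = 2) (u v : X) (hli : LinearIndependent ℝ ![u, v])
    (h : DifferentiableAt ℝ (fun t : ℝ => ‖u + t • v‖) 0) :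
    DifferentiableAt ℝ (fun z : X => ‖z‖) u := by
  let B := basisOfLinearIndependentOfCardEqFinrank hli (by simp [hdim])
  let α : X →L[ℝ] ℝ := LinearMap.toContinuousLinearMap (B.coord 0)
  let β : X →L[ℝ] ℝ := LinearMap.toContinuousLinearMap (B.coord 1)
  have hB0 : B 0 = u := by simp [B]
  have hB1 : B 1 = v := by simp [B]
  have hdec : ∀ z, z = α z • u + β z • v := by
    intro z
    have := B.sum_repr z
    rw [Fin.sum_univ_two, hB0, hB1] at this
    exact this.symm
  have hα : α u = 1 := by
    show B.coord 0 u = 1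
    rw [← hB0]; simp
  have hβ : β u = 0 := by
    show B.coord 1 u = 0
    rw [← hB0]; simp
  have hk : DifferentiableAt ℝ (fun z : X => α z * ‖u + (β z / α z) • v‖) u := by
    refine α.differentiableAt.mul ?_
    have hq : DifferentiableAt ℝ (fun z : X => β z / α z) u :=
      by
        simp only [div_eq_mul_inv]
        refine DifferentiableAt.fun_mul β.differentiableAt ?_
        refine DifferentiableAt.comp (g := fun t : ℝ => t⁻¹) u ?_ α.differentiableAt
        exact differentiableAt_inv (by rw [hα]; exact one_ne_zero)
    refine DifferentiableAt.comp (g := fun t : ℝ => ‖u + t • v‖) u ?_ hq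
    simpa [hβ] using h
  refine hk.congr_of_eventuallyEq ?_
  have : ∀ᶠ z in 𝓝 u, 0 < α z :=
    α.continuous.continuousAt.eventually (lt_mem_nhds (by rw [hα]; exact one_pos))
  filter_upwards [this] with z hz
  conv_lhs => rw [hdec z]
  rw [← abs_of_pos hz, ← Real.norm_eq_abs, ← norm_smul, Real.norm_eq_abs, abs_of_pos hz, smul_add,
    smul_smul, mul_div_cancel₀ _ hz.ne']

lemma aux_little {X : Type*} [NormedAddCommGroup X] [NormedSpace ℝ X] (f : ℝ → X) (f' : X) (b : ℝ)
    (w : X) (h : HasDerivAt f f' b) (d : ℝ) :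
    HasDerivAt (fun t : ℝ => ‖f (b + t) - w‖) d 0 ↔
    HasDerivAt (fun t : ℝ => ‖f b - w + t • f'‖) d 0 := by
  have h1 := hasDerivAt_iff_isLittleO_nhds_zero.1 h
  have h2 : (fun t : ℝ => ‖f (b + t) - w‖ - ‖f b - w + t • f'‖) =o[𝓝 0] fun t => t := by
    refine Asymptotics.IsBigO.trans_isLittleO ?_ h1
    refine Asymptotics.isBigO_of_le _ fun t => ?_
    refine (abs_norm_sub_norm_le _ _).trans (le_of_eq ?_)
    congr 1; abel
  have h3 : HasDerivAt (fun t : ℝ => ‖f (b + t) - w‖ - ‖f b - w + t • f'‖) 0 0 := by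
    rw [hasDerivAt_iff_isLittleO_nhds_zero]
    simpa using h2
  constructor
  · intro h; simpa using h.fun_sub h3
  · intro h; simpa using h.fun_add h3

lemma aux_slope (f : ℝ → ℝ) (f' c s : ℝ) (S : Set ℝ) (hS : (𝓝[S \ {s}] s).NeBot)
    (hf : HasDerivWithinAt f f' S s) (h0 : f s = 0)
    (h : ∀ᶠ z in 𝓝 s, c * (z - s) ^ 2 ≤ f z * (z - s)) : c ≤ f' := by
  have h1 := hasDerivWithinAt_iff_tendsto_slope.1 hf
  refine ge_of_tendsto h1 ?_
  have h2 : ∀ᶠ z in 𝓝[S \ {s}] s, z ∈ S \ {s} := self_mem_nhdsWithin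
  filter_upwards [h2, h.filter_mono nhdsWithin_le_nhds] with z hz hz'
  have hne : z - s ≠ 0 := sub_ne_zero.2 hz.2
  have hpos : 0 < (z - s) ^ 2 := by positivity
  rw [slope_def_field, h0, sub_zero]
  have : f z / (z - s) = f z * (z - s) / (z - s) ^ 2 := by field_simp
  rw [this, le_div_iff₀ hpos]
  exact hz'

lemma aux_sin (t : ℝ) (h : |t| ≤ Real.pi / 2) : 2 / Real.pi * t ^ 2 ≤ Real.sin t * t := by
  rcases le_total 0 t with ht | ht
  · have := Real.mul_le_sin ht (by rwa [abs_of_nonneg ht] at h)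
    nlinarith
  · have := Real.sin_le_mul (x := t) (by rw [abs_of_nonpos ht] at h; linarith) ht
    nlinarith

/-- Let `a, b, s ∈ ℝ` be such that the natural parameterization `r` is differentiable at
`b`, `0 ≠ r b - r a = ‖r b - r a‖ • r s`, and `r' b = x • r s + y • r'±(s)` with `y ≠ 0`.
Then `r` is differentiable at `s` iff the map `ν : ε ↦ ‖r (b+ε) - r a‖` is differentiable
at `0`. -/
theorem natural_parameterization_differentiable_iff
    {X : Type*} [NormedAddCommGroup X] [NormedSpace ℝ X] [CompleteSpace X]
    (hdim : Module.finrank ℝ X = 2)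
    (e₁ e₂ : X) (hInd : LinearIndependent ℝ ![e₁, e₂])
    (p : ℝ → X)
    (hp : ∀ t, p t = ‖Real.cos t • e₁ + Real.sin t • e₂‖⁻¹ •
      (Real.cos t • e₁ + Real.sin t • e₂))
    (σ : ℝ → ℝ) (hσ : ∀ t, σ t = ∫ u in (0:ℝ)..t, ‖derivWithin p (Ici u) u‖)
    (τ : ℝ → ℝ) (hτ_cont : Continuous τ) (hτ_mono : StrictMono τ)
    (hστ : ∀ x, σ (τ x) = x)
    (r : ℝ → X) (hr : ∀ s, r s = p (τ s))
    (a b s : ℝ)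
    -- the one-sided derivatives of `r` at `s`
    (dm dp : X)
    (hdm : HasDerivWithinAt r dm (Iic s) s) (hdp : HasDerivWithinAt r dp (Ici s) s)
    -- `r` is differentiable at `b`, with derivative `rb = x • r s + y • r'±(s)`, `y ≠ 0`
    (rb : X) (hb : HasDerivAt r rb b)
    (hne : r b - r a ≠ 0) (heq : r b - r a = ‖r b - r a‖ • r s)
    (x y : ℝ) (hxy : rb = x • r s + y • ((1/2 : ℝ) • (dp + dm))) (hy : y ≠ 0) :
    DifferentiableAt ℝ r s ↔
      DifferentiableAt ℝ (fun ε : ℝ => ‖r (b + ε) - r a‖) (0 : ℝ) := by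
  have hfd : FiniteDimensional ℝ X := Module.finite_of_finrank_pos (by rw [hdim]; norm_num)
  set E : ℝ → X := fun t => Real.cos t • e₁ + Real.sin t • e₂ with hE
  let B := basisOfLinearIndependentOfCardEqFinrank hInd (by simp [hdim])
  let c1 : X →L[ℝ] ℝ := LinearMap.toContinuousLinearMap (B.coord 0)
  let c2 : X →L[ℝ] ℝ := LinearMap.toContinuousLinearMap (B.coord 1)
  have hB0 : B 0 = e₁ := by simp [B]
  have hB1 : B 1 = e₂ := by simp [B]
  have h11 : c1 e₁ = 1 := by
    show B.coord 0 e₁ = 1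
    rw [← hB0]; simp
  have h12 : c1 e₂ = 0 := by
    show B.coord 0 e₂ = 0
    rw [← hB1]; simp
  have h21 : c2 e₁ = 0 := by
    show B.coord 1 e₁ = 0
    rw [← hB0]; simp
  have h22 : c2 e₂ = 1 := by
    show B.coord 1 e₂ = 1
    rw [← hB1]; simp
  clear_value c1 c2
  have hc1 : ∀ t, c1 (E t) = Real.cos t := by intro t; simp [hE, h11, h12]
  have hc2 : ∀ t, c2 (E t) = Real.sin t := by intro t; simp [hE, h21, h22]
  -- bounds on the norm of `E`
  set K : ℝ := ‖c1‖ + ‖c2‖ with hK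
  set H : ℝ := ‖e₁‖ + ‖e₂‖ with hH
  have hKE : ∀ t, 1 ≤ K * ‖E t‖ := by
    intro t
    have a1 := c1.le_opNorm (E t)
    have a2 := c2.le_opNorm (E t)
    rw [hc1, Real.norm_eq_abs] at a1
    rw [hc2, Real.norm_eq_abs] at a2
    have a3 := Real.sin_sq_add_cos_sq t
    have a4 := Real.abs_cos_le_one t
    have a5 := Real.abs_sin_le_one t
    have a6 := abs_nonneg (Real.cos t)
    have a7 := abs_nonneg (Real.sin t)
    rw [← sq_abs (Real.sin t), ← sq_abs (Real.cos t)] at a3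
    nlinarith
  have hK0 : 0 < K := by
    have a1 := hKE 0
    have a2 : 0 ≤ K := by positivity
    rcases a2.eq_or_lt with h | h
    · rw [← h] at a1; norm_num at a1
    · exact h
  have hE0 : ∀ t, 0 < ‖E t‖ := by
    intro t
    by_contra hcon
    have : ‖E t‖ = 0 := le_antisymm (not_lt.1 hcon) (norm_nonneg _)
    have a1 := hKE t
    rw [this] at a1; norm_num at a1
  have hEH : ∀ t, ‖E t‖ ≤ H := by
    intro t
    refine (norm_add_le _ _).trans ?_
    rw [norm_smul, norm_smul, Real.norm_eq_abs, Real.norm_eq_abs]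
    have a4 := Real.abs_cos_le_one t
    have a5 := Real.abs_sin_le_one t
    have := norm_nonneg e₁
    have := norm_nonneg e₂
    nlinarith
  have hH0 : 0 < H := (hE0 0).trans_le (hEH 0)
  have hEL : ∀ t u, ‖E t - E u‖ ≤ H * |t - u| := by
    intro t u
    have : E t - E u = (Real.cos t - Real.cos u) • e₁ + (Real.sin t - Real.sin u) • e₂ := by
      simp only [hE, sub_smul]; abel
    rw [this]
    refine (norm_add_le _ _).trans ?_
    rw [norm_smul, norm_smul, Real.norm_eq_abs, Real.norm_eq_abs]
    have a1 : |Real.cos t - Real.cos u| ≤ |t - u| := by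
      simpa [Real.dist_eq] using Real.lipschitzWith_cos.dist_le_mul t u
    have a2 : |Real.sin t - Real.sin u| ≤ |t - u| := by
      simpa [Real.dist_eq] using Real.lipschitzWith_sin.dist_le_mul t u
    have := norm_nonneg e₁
    have := norm_nonneg e₂
    nlinarith
  have hp' : ∀ t, p t = ‖E t‖⁻¹ • E t := hp
  have hpn : ∀ t, ‖p t‖ = 1 := by
    intro t
    rw [hp', norm_smul, norm_inv, norm_norm, inv_mul_cancel₀ (hE0 t).ne']
  have hEp : ∀ t, E t = ‖E t‖ • p t := by
    intro t
    rw [hp', smul_smul, mul_inv_cancel₀ (hE0 t).ne', one_smul]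
  -- `p` is Lipschitz
  have hpL : ∀ t u, ‖p t - p u‖ ≤ 2 * H * K * |t - u| := by
    intro t u
    have e1 : ‖E t‖ • (p t - p u) = (E t - E u) - (‖E t‖ - ‖E u‖) • p u := by
      rw [smul_sub, ← hEp, sub_smul, ← hEp]; abel
    have e2 : ‖E t‖ * ‖p t - p u‖ ≤ 2 * (H * |t - u|) := by
      rw [← abs_of_pos (hE0 t), ← Real.norm_eq_abs, ← norm_smul, e1]
      refine (norm_sub_le _ _).trans ?_
      rw [norm_smul, hpn, Real.norm_eq_abs]
      have := abs_norm_sub_norm_le (E t) (E u)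
      have := hEL t u
      linarith
    have e3 := hKE t
    have e4 := norm_nonneg (p t - p u)
    calc ‖p t - p u‖ ≤ (K * ‖E t‖) * ‖p t - p u‖ := le_mul_of_one_le_left e4 e3
      _ = K * (‖E t‖ * ‖p t - p u‖) := by ring
      _ ≤ K * (2 * (H * |t - u|)) := by gcongr
      _ = _ := by ring
  have hC0 : 0 < 2 * H * K := by positivity
  set C : NNReal := ⟨2 * H * K, hC0.le⟩ with hC
  have hCpos : (0:ℝ) < C := hC0
  have hpLip : LipschitzWith C p := by
    refine LipschitzWith.of_dist_le_mul fun t u => ?_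
    rw [dist_eq_norm, Real.dist_eq]
    exact hpL t u
  obtain ⟨hσL, hσD⟩ := aux_sigma p C hpLip σ hσ
  have hτL : ∀ u v, |u - v| ≤ C * |τ u - τ v| := by
    intro u v
    have := hσL (τ u) (τ v)
    rwa [hστ, hστ] at this
  -- the transversal functional
  set t0 := τ s with ht0
  let D : X →L[ℝ] ℝ := Real.cos t0 • c2 - Real.sin t0 • c1
  have hDE : ∀ t, D (E t) = Real.sin (t - t0) := by
    intro t
    show Real.cos t0 * c2 (E t) - Real.sin t0 * c1 (E t) = _
    rw [hc1, hc2, Real.sin_sub]; ring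
  clear_value D
  have hDp : ∀ t, D (p t) = ‖E t‖⁻¹ * Real.sin (t - t0) := by
    intro t; rw [hp', map_smul, hDE, smul_eq_mul]
  have hDrs : D (r s) = 0 := by rw [hr, hDp]; simp [ht0]
  have hpi := Real.pi_pos
  have hDpge : ∀ t, |t - t0| ≤ Real.pi / 2 →
      H⁻¹ * (2 / Real.pi) * (t - t0) ^ 2 ≤ D (p t) * (t - t0) := by
    intro t ht
    have e1 := aux_sin _ ht
    have e2 : H⁻¹ ≤ ‖E t‖⁻¹ := inv_anti₀ (hE0 t) (hEH t)
    rw [hDp, mul_assoc, mul_assoc]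
    exact mul_le_mul e2 e1 (by positivity) (by have := hE0 t; positivity)
  set k : ℝ := H⁻¹ * (2 / Real.pi) with hk
  have hk0 : 0 < k := by positivity
  have hDr : ∀ᶠ z in 𝓝 s, k / C * (z - s) ^ 2 ≤ D (r z) * (z - s) := by
    have e1 : ∀ᶠ z in 𝓝 s, |τ z - t0| < Real.pi / 2 := by
      have : ContinuousAt (fun z => |τ z - t0|) s := by fun_prop
      refine this.eventually (gt_mem_nhds ?_)
      simp only [ht0, sub_self, abs_zero]; positivity
    filter_upwards [e1] with z hz
    have e2 := hDpge (τ z) hz.le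
    rw [← hr] at e2
    have e3 := hτL z s
    rcases lt_trichotomy z s with hzs | hzs | hzs
    · have e4 : τ z - t0 < 0 := sub_neg.2 (hτ_mono hzs)
      have e5 : z - s < 0 := sub_neg.2 hzs
      rw [abs_of_neg e4, abs_of_neg e5] at e3
      have e6 : D (r z) ≤ k * (τ z - t0) := by nlinarith
      have e7 : D (r z) ≤ k / C * (z - s) := by
        refine e6.trans ?_
        rw [div_mul_eq_mul_div, le_div_iff₀ hCpos]
        nlinarith
      nlinarith
    · subst hzs; simp
    · have e4 : 0 < τ z - t0 := sub_pos.2 (hτ_mono hzs)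
      have e5 : 0 < z - s := sub_pos.2 hzs
      rw [abs_of_pos e4, abs_of_pos e5] at e3
      have e6 : k * (τ z - t0) ≤ D (r z) := by nlinarith
      have e7 : k / C * (z - s) ≤ D (r z) := by
        refine le_trans ?_ e6
        rw [div_mul_eq_mul_div, div_le_iff₀ hCpos]
        nlinarith
      nlinarith
  have hkC : 0 < k / C := by positivity
  have hDdp : 0 < D dp := by
    refine hkC.trans_le (aux_slope (fun z => D (r z)) _ _ s (Ici s) ?_ ?_ hDrs hDr)
    · rw [Ici_sdiff_left]; infer_instance
    · exact D.hasFDerivAt.comp_hasDerivWithinAt s hdp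
  have hDdm : 0 < D dm := by
    refine hkC.trans_le (aux_slope (fun z => D (r z)) _ _ s (Iic s) ?_ ?_ hDrs hDr)
    · rw [Iic_sdiff_right]; infer_instance
    · exact D.hasFDerivAt.comp_hasDerivWithinAt s hdm
  set w : X := (1/2 : ℝ) • (dp + dm) with hw
  have hDw : D w ≠ 0 := by
    have : D w = 1 / 2 * (D dp + D dm) := by
      rw [hw, map_smul, map_add, smul_eq_mul]
    rw [this]; positivity
  have hrs : r s ≠ 0 := by
    intro h
    have := hpn (τ s)
    rw [← hr, h, norm_zero] at this
    exact zero_ne_one this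
  have hli : ∀ u v : X, u ≠ 0 → D u = 0 → D v ≠ 0 → LinearIndependent ℝ ![u, v] := by
    intro u v hu hDu hDv
    rw [LinearIndependent.pair_iff]
    intro α β h
    have h1 : D (α • u + β • v) = 0 := by rw [h, map_zero]
    rw [map_add, map_smul, map_smul, hDu, smul_zero, zero_add, smul_eq_mul] at h1
    have h2 : β = 0 := (mul_eq_zero.1 h1).resolve_right hDv
    subst h2
    rw [zero_smul, add_zero] at h
    exact ⟨(smul_eq_zero.1 h).resolve_right hu, rfl⟩
  have hL : ‖r b - r a‖ ≠ 0 := norm_ne_zero_iff.2 hne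
  constructor
  · intro hd
    have e1 : deriv r s = dp :=
      (uniqueDiffOn_Ici s s self_mem_Ici).eq_deriv _ hd.hasDerivAt.hasDerivWithinAt hdp
    have e2 : deriv r s = dm :=
      (uniqueDiffOn_Iic s s self_mem_Iic).eq_deriv _ hd.hasDerivAt.hasDerivWithinAt hdm
    have e3 : w = deriv r s := by
      rw [hw, ← e1, ← e2, ← two_smul ℝ, smul_smul]; norm_num
    have e4 : HasDerivAt (fun t : ℝ => ‖r (s + t) - 0‖) 0 0 := by
      have : (fun t : ℝ => ‖r (s + t) - 0‖) = fun _ => 1 := by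
        funext t; rw [sub_zero, hr, hpn]
      rw [this]; exact hasDerivAt_const _ _
    have e5 := (aux_little r (deriv r s) s 0 hd.hasDerivAt 0).1 e4
    rw [← e3, sub_zero] at e5
    have e6 := aux_norm_diff hdim (r s) w (hli _ _ hrs hDrs hDw) e5.differentiableAt
    have e7 : DifferentiableAt ℝ (fun z : X => ‖z‖) (r b - r a) := by
      rw [heq]; exact (differentiableAt_norm_smul hL).1 e6
    refine DifferentiableAt.comp (g := fun z : X => ‖z‖) (f := fun ε => r (b + ε) - r a) 0 ?_ ?_
    · simpa using e7
    · have : DifferentiableAt ℝ (fun ε => r (b + ε)) 0 := by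
        refine DifferentiableAt.comp (g := r) (f := fun ε => b + ε) 0 ?_ (by fun_prop)
        simpa using hb.differentiableAt
      exact this.sub_const _
  · intro hν
    have e1 := (aux_little r rb b (r a) hb _).1 hν.hasDerivAt
    have e2 : D (r b - r a) = 0 := by rw [heq, map_smul, hDrs, smul_zero]
    have e3 : D rb ≠ 0 := by
      rw [hxy, map_add, map_smul, map_smul, hDrs, smul_zero, zero_add, smul_eq_mul]
      exact mul_ne_zero hy hDw
    have e4 := aux_norm_diff hdim _ _ (hli _ _ hne e2 e3) e1.differentiableAt
    rw [heq] at e4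
    have e5 : DifferentiableAt ℝ (fun z : X => ‖z‖) (r s) := (differentiableAt_norm_smul hL).2 e4
    have e6 : DifferentiableAt ℝ (fun z : X => ‖z‖) (E t0) := by
      rw [hEp, ht0, ← hr]
      exact (differentiableAt_norm_smul (hE0 _).ne').1 e5
    have e7 := aux_strict e6
    have e8 : HasStrictDerivAt E (-Real.sin t0 • e₁ + Real.cos t0 • e₂) t0 :=
      ((Real.hasStrictDerivAt_cos t0).smul_const e₁).fun_add
        ((Real.hasStrictDerivAt_sin t0).smul_const e₂)
    have e9 := e7.comp_hasStrictDerivAt t0 e8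
    obtain ⟨p', e10⟩ : ∃ p', HasStrictDerivAt p p' t0 := by
      have : p = fun t => ‖E t‖⁻¹ • E t := funext hp'
      rw [this]
      have hi : HasStrictDerivAt (fun t => ‖E t‖⁻¹) _ t0 :=
        HasStrictDerivAt.comp t0 (hasStrictDerivAt_inv (hE0 t0).ne') e9
      exact ⟨_, hi.fun_smul e8⟩
    have e11 := hσD t0 p' e10
    have e12 : p' ≠ 0 := by
      have hge : k ≤ D p' := by
        refine aux_slope (fun z => D (p z)) _ _ t0 univ ?_ ?_ (by rw [← hDrs, hr]) ?_
        · rw [← compl_eq_univ_sdiff]; infer_instance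
        · exact (D.hasFDerivAt.comp_hasDerivAt t0 e10.hasDerivAt).hasDerivWithinAt
        · have : ContinuousAt (fun z => |z - t0|) t0 := by fun_prop
          have hlt : |t0 - t0| < Real.pi / 2 := by rw [sub_self, abs_zero]; positivity
          have := this.eventually (gt_mem_nhds hlt)
          filter_upwards [this] with z hz
          exact hDpge z hz.le
      intro h
      rw [h, map_zero] at hge
      linarith
    have e13 : HasDerivAt τ ‖p'‖⁻¹ s :=
      HasDerivAt.of_local_left_inverse hτ_cont.continuousAt e11 (norm_ne_zero_iff.2 e12)
        (Eventually.of_forall hστ)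
    have e14 : r = fun z => p (τ z) := funext hr
    rw [e14]
    exact (e10.hasDerivAt.differentiableAt).comp s e13.differentiableAt
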